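/- There is a function f : ℕ × ℕ → ℝ satisfying the following. Let Γ be an abelian group and let A ⊆ Γ be a non-empty set such that Γ \ A is a subgroup of Γ. Let (G, γ) be a Γ-labelled graph. If arb_{(Γ,A)}(G, γ) ≥ f(t, d), then G contains an (A, d)-subdivision of K_t. -/

import Mathlib

namespace ArbPaper

universe u v

/-- The `γ`-value of a walk: the sum of the labels of its edges. -/
def walkVal {V : Type u} {Γ : Type v} [AddCommGroup Γ] {G : SimpleGraph V}
    (γ : Sym2 V → Γ) {x y : V} (w : G.Walk x y) : Γ :=
  (w.edges.map γ).sum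

/-- The set `S` induces a subgraph having no cycle of `γ`-value in `A`. -/
def NoCycleValIn {V : Type u} {Γ : Type v} [AddCommGroup Γ] (G : SimpleGraph V)
    (γ : Sym2 V → Γ) (A : Set Γ) (S : Set V) : Prop :=
  ∀ (v : V) (w : G.Walk v v), w.IsCycle → (∀ x ∈ w.support, x ∈ S) →
    walkVal γ w ∉ A

/-- The `(Γ, A)`-vertex-arboricity of the subgraph of `G` induced on `S`:
the minimum number of parts in a partition of `S` such that each part induces
a subgraph having no cycle of `γ`-value in `A`. -/
noncomputable def arbOn {V : Type u} {Γ : Type v} [AddCommGroup Γ] (G : SimpleGraph V)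
    (γ : Sym2 V → Γ) (A : Set Γ) (S : Set V) : ℕ :=
  sInf {k : ℕ | ∃ f : V → Fin k,
    ∀ i : Fin k, NoCycleValIn G γ A {v | v ∈ S ∧ f v = i}}

/-- The `(Γ, A)`-vertex-arboricity of `(G, γ)`. -/
noncomputable def arb {V : Type u} {Γ : Type v} [AddCommGroup Γ] (G : SimpleGraph V)
    (γ : Sym2 V → Γ) (A : Set Γ) : ℕ :=
  arbOn G γ A Set.univ

/-- `G` contains an `(A, d)`-cycle: a cycle of `γ`-value in `A` and length at least `d`. -/
def ContainsADCycle {V : Type u} {Γ : Type v} [AddCommGroup Γ] (G : SimpleGraph V)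
    (γ : Sym2 V → Γ) (A : Set Γ) (d : ℕ) : Prop :=
  ∃ (v : V) (w : G.Walk v v), w.IsCycle ∧ walkVal γ w ∈ A ∧ d ≤ w.length

/-- `b` (the branching vertices) together with the branching paths `P i j` (for `i < j`)
form a subdivision of the complete graph `K t` inside `G`. -/
def IsKtSubdivision {V : Type u} (G : SimpleGraph V) (t : ℕ) (b : Fin t → V)
    (P : ∀ i j : Fin t, G.Walk (b i) (b j)) : Prop :=
  Function.Injective b ∧
  (∀ i j : Fin t, i < j → (P i j).IsPath) ∧
  (∀ i j : Fin t, i < j → ∀ v ∈ (P i j).support, v ∈ Set.range b → v = b i ∨ v = b j) ∧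
  (∀ i j k l : Fin t, i < j → k < l → (i, j) ≠ (k, l) → ∀ v,
    v ∈ (P i j).support → v ∈ (P k l).support →
      (v = b i ∨ v = b j) ∧ (v = b k ∨ v = b l))

/-- `G` itself is (as a whole) a subdivision of `K t` with data `b`, `P`:
every vertex and every edge of `G` lies on some branching path. -/
def IsSpanningKtSubdivision {V : Type u} (G : SimpleGraph V) (t : ℕ) (b : Fin t → V)
    (P : ∀ i j : Fin t, G.Walk (b i) (b j)) : Prop :=
  IsKtSubdivision G t b P ∧
  (∀ v : V, ∃ i j : Fin t, i < j ∧ v ∈ (P i j).support) ∧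
  (∀ e ∈ G.edgeSet, ∃ i j : Fin t, i < j ∧ e ∈ (P i j).edges)

/-- `G` contains an `(A, d)`-subdivision of `K t`: a subdivision of `K t` in which every
branching path has `γ`-value in `A` and length at least `d`. -/
def ContainsADSubdivision {V : Type u} {Γ : Type v} [AddCommGroup Γ] (G : SimpleGraph V)
    (γ : Sym2 V → Γ) (A : Set Γ) (t d : ℕ) : Prop :=
  ∃ (b : Fin t → V) (P : ∀ i j : Fin t, G.Walk (b i) (b j)),
    IsKtSubdivision G t b P ∧
    ∀ i j : Fin t, i < j → walkVal γ (P i j) ∈ A ∧ d ≤ (P i j).length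

/-- `w` is an `X`-path lying inside the induced subgraph `G[Y]`: a path of length at
least `2` whose endpoints lie in `X`, internal vertices lie outside `X`, and all of
whose vertices lie in `Y`. -/
def IsXPathIn {V : Type u} (G : SimpleGraph V) (X Y : Set V) {x y : V}
    (w : G.Walk x y) : Prop :=
  w.IsPath ∧ 2 ≤ w.length ∧ x ∈ X ∧ y ∈ X ∧
  (∀ v ∈ w.support, v ∈ Y) ∧
  (∀ v ∈ w.support, v ≠ x → v ≠ y → v ∉ X)

/-- `(L 0, L 1, …, L p)` is a leveling of the connected graph `G`. -/
def IsLeveling {V : Type u} (G : SimpleGraph V) (p : ℕ) (L : ℕ → Set V) : Prop :=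
  (∀ i j, i ≤ p → j ≤ p → i ≠ j → Disjoint (L i) (L j)) ∧
  (∃ v : V, L 0 = {v}) ∧
  (∀ v : V, ∃ i, i ≤ p ∧ v ∈ L i) ∧
  (∀ i, 1 ≤ i → i ≤ p → ∀ v ∈ L i,
    (∃ u ∈ L (i - 1), G.Adj v u) ∧ (∀ j, j + 2 ≤ i → ∀ u ∈ L j, ¬ G.Adj v u))

/-- `G[Y]` is a connected component of `G[S]`. -/
def IsCompOf {V : Type u} (G : SimpleGraph V) (Y S : Set V) : Prop :=
  Y ⊆ S ∧ (G.induce Y).Connected ∧ ∀ u ∈ Y, ∀ v ∈ S, G.Adj u v → v ∈ Y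


section Helpers

variable {V : Type u} {Γ : Type v} [AddCommGroup Γ] {G : SimpleGraph V}

open SimpleGraph

/-- `S` can be coloured with `k` colours without monochromatic cycles of value in `A`. -/
def Col (G : SimpleGraph V) (γ : Sym2 V → Γ) (A : Set Γ) (S : Set V) (k : ℕ) : Prop :=
  ∃ f : V → ℕ, (∀ v ∈ S, f v < k) ∧ ∀ i, NoCycleValIn G γ A {v | v ∈ S ∧ f v = i}

lemma walkVal_append (γ : Sym2 V → Γ) {x y z : V} (p : G.Walk x y) (q : G.Walk y z) :
    walkVal γ (p.append q) = walkVal γ p + walkVal γ q := by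
  simp [walkVal, Walk.edges_append]

lemma walkVal_reverse (γ : Sym2 V → Γ) {x y : V} (p : G.Walk x y) :
    walkVal γ p.reverse = walkVal γ p := by
  simp [walkVal, Walk.edges_reverse]

lemma walkVal_cons (γ : Sym2 V → Γ) {x y z : V} (h : G.Adj x y) (p : G.Walk y z) :
    walkVal γ (Walk.cons h p) = γ s(x, y) + walkVal γ p := by
  simp [walkVal]

lemma isPath_append {x y z : V} {p : G.Walk x y} {q : G.Walk y z} (hp : p.IsPath)
    (hq : q.IsPath) (h : ∀ v, v ∈ p.support → v ∈ q.support → v = y) :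
    (p.append q).IsPath := by
  induction p with
  | nil => simpa using hq
  | cons hadj p ih =>
    rw [Walk.cons_isPath_iff] at hp
    rw [Walk.cons_append, Walk.cons_isPath_iff]
    refine ⟨ih hp.1 hq (fun v hv hv' => h v (by simp [hv]) hv'), ?_⟩
    rw [Walk.mem_support_append_iff]
    rintro (h1 | h1)
    · exact hp.2 h1
    · have := h _ (by simp) h1
      subst this
      exact hp.2 (by simp)

lemma NoCycleValIn.mono {γ : Sym2 V → Γ} {A : Set Γ} {S T : Set V}
    (h : NoCycleValIn G γ A T) (hST : S ⊆ T) : NoCycleValIn G γ A S :=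
  fun v w hw hs => h v w hw (fun x hx => hST (hs x hx))

lemma noCycle_of_subsingleton {γ : Sym2 V → Γ} {A : Set Γ} {S : Set V}
    (h : S.Subsingleton) : NoCycleValIn G γ A S := by
  intro v w hw hs
  exfalso
  cases w with
  | nil => exact hw.not_nil (by simp)
  | cons hadj p =>
    exact hadj.ne (h (hs _ (by simp)) (hs _ (by simp)))

lemma Col.union {γ : Sym2 V → Γ} {A : Set Γ} {S T : Set V} {m n : ℕ}
    (h1 : Col G γ A S m) (h2 : Col G γ A T n) : Col G γ A (S ∪ T) (m + n) := by
  classical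
  obtain ⟨f, hf, hf'⟩ := h1
  obtain ⟨g, hg, hg'⟩ := h2
  refine ⟨fun v => if v ∈ S then f v else m + g v, ?_, ?_⟩
  · intro v hv
    by_cases h : v ∈ S
    · have := hf v h
      simp only [h, if_true]; omega
    · have := hg v (hv.resolve_left h)
      simp only [h, if_false]; omega
  · intro i
    by_cases hi : i < m
    · refine (hf' i).mono ?_
      rintro v ⟨hv, hvi⟩
      by_cases h : v ∈ S
      · simp only [h, if_true] at hvi
        exact ⟨h, hvi⟩
      · simp only [h, if_false] at hvi
        omega
    · refine (hg' (i - m)).mono ?_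
      rintro v ⟨hv, hvi⟩
      by_cases h : v ∈ S
      · simp only [h, if_true] at hvi
        have := hf v h
        omega
      · simp only [h, if_false] at hvi
        exact ⟨hv.resolve_left h, by omega⟩

lemma Col.mono {γ : Sym2 V → Γ} {A : Set Γ} {S T : Set V} {m n : ℕ}
    (h1 : Col G γ A T m) (hST : S ⊆ T) (hmn : m ≤ n) : Col G γ A S n := by
  obtain ⟨f, hf, hf'⟩ := h1
  exact ⟨f, fun v hv => (hf v (hST hv)).trans_le hmn,
    fun i => (hf' i).mono (fun v hv => ⟨hST hv.1, hv.2⟩)⟩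

lemma col_subsingleton {γ : Sym2 V → Γ} {A : Set Γ} {S : Set V} (h : S.Subsingleton) :
    Col G γ A S 1 :=
  ⟨fun _ => 0, fun _ _ => one_pos,
    fun _ => noCycle_of_subsingleton (fun _ hx _ hy => h hx.1 hy.1)⟩

lemma pick {γ : Sym2 V → Γ} {A : Set Γ} {S : Set V} {n : ℕ} (h : ¬ Col G γ A S (n + 1)) :
    ∃ w ∈ S, ¬ Col G γ A (S \ {w}) n := by
  by_cases hS : S.Nonempty
  · obtain ⟨w, hw⟩ := hS
    refine ⟨w, hw, fun hc => h ?_⟩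
    refine (hc.union (col_subsingleton (Set.subsingleton_singleton (a := w)))).mono ?_ le_rfl
    intro x hx
    by_cases hxw : x = w
    · right; exact hxw
    · left; exact ⟨hx, hxw⟩
  · rw [Set.not_nonempty_iff_eq_empty] at hS
    subst hS
    exact absurd ((col_subsingleton Set.subsingleton_empty).mono le_rfl (by omega)) h

/-- Split off a set containing a cycle of value in `A`. -/
lemma pickCycle [Finite V] {γ : Sym2 V → Γ} {A : Set Γ} {Y : Set V} {n : ℕ}
    (h : ¬ Col G γ A Y (n + 2)) :
    ∃ S ⊆ Y, ¬ Col G γ A (Y \ S) n ∧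
      ∃ (v : V) (w : G.Walk v v), w.IsCycle ∧ (∀ x ∈ w.support, x ∈ S) ∧ walkVal γ w ∈ A := by
  have hY1 : ¬ Col G γ A Y 1 := fun hc => h (hc.mono le_rfl (by omega))
  obtain ⟨S, hSY, hS⟩ := exists_minimal_le_of_wellFoundedLT (fun S => ¬ Col G γ A S 1) Y hY1
  refine ⟨S, hSY, ?_, ?_⟩
  · intro hc
    apply h
    obtain ⟨w, hw, hw'⟩ := pick (n := 0) hS.prop
    have h1 : Col G γ A (S \ {w}) 1 := by
      by_contra hcon
      exact (hS.le_of_le hcon Set.sdiff_subset hw).2 rfl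
    have h2 : Col G γ A S 2 := by
      refine (h1.union (col_subsingleton (Set.subsingleton_singleton (a := w)))).mono ?_ le_rfl
      intro x hx
      by_cases hxw : x = w
      · right; exact hxw
      · left; exact ⟨hx, hxw⟩
    refine (hc.union h2).mono ?_ le_rfl
    intro x hx
    by_cases hxS : x ∈ S
    · right; exact hxS
    · left; exact ⟨hx, hxS⟩
  · by_contra hcon
    push Not at hcon
    exact hS.prop ⟨fun _ => 0, fun _ _ => one_pos,
      fun i v w hw hs => hcon v w hw (fun x hx => (hs x hx).1)⟩

/-- `C` is connected (any two vertices are joined by a walk inside `C`). -/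
def Conn (G : SimpleGraph V) (C : Set V) : Prop :=
  ∀ x ∈ C, ∀ y ∈ C, ∃ w : G.Walk x y, ∀ z ∈ w.support, z ∈ C

lemma const_on_walk {α : Type*} (φ : V → α) {X : Set V}
    (hφ : ∀ x ∈ X, ∀ y ∈ X, G.Adj x y → φ x = φ y) {a b : V} (w : G.Walk a b)
    (hw : ∀ x ∈ w.support, x ∈ X) : ∀ x ∈ w.support, φ x = φ a := by
  induction w with
  | nil => intro x hx; simp at hx; rw [hx]
  | cons hadj p ih =>
    intro x hx
    rw [Walk.support_cons, List.mem_cons] at hx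
    rcases hx with rfl | hx
    · rfl
    · rw [ih (fun x hx => hw x (by simp [hx])) x hx]
      exact (hφ _ (hw _ (by simp)) _ (hw _ (by simp)) hadj).symm

lemma step {γ : Sym2 V → Γ} {A : Set Γ} {S : Set V} {n : ℕ} (hn : 1 ≤ n)
    (h : ¬ Col G γ A S (2 * n)) :
    ∃ C Y : Set V, C ⊆ S ∧ Y ⊆ S ∧ Disjoint C Y ∧ Conn G C ∧
      (∀ y ∈ Y, ∃ c ∈ C, G.Adj y c) ∧ ¬ Col G γ A Y n := by
  classical
  by_contra hcon
  push Not at hcon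
  let H : SimpleGraph V :=
    { Adj := fun u v => G.Adj u v ∧ u ∈ S ∧ v ∈ S
      symm := ⟨fun u v h => ⟨h.1.symm, h.2.2, h.2.1⟩⟩
      loopless := ⟨fun u h => h.1.ne rfl⟩ }
  have HG : ∀ u v, H.Adj u v → G.Adj u v := fun u v h => h.1
  let root : H.ConnectedComponent → V := fun c => Quot.out c
  have hroot : ∀ c, H.connectedComponentMk (root c) = c := fun c => Quot.out_eq c
  have hreach : ∀ v, H.Reachable v (root (H.connectedComponentMk v)) := fun v =>
    SimpleGraph.ConnectedComponent.exact (hroot _).symm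
  let D : V → ℕ := fun v => H.dist v (root (H.connectedComponentMk v))
  have hDadj : ∀ u v, H.Adj u v → D u ≤ D v + 1 := by
    intro u v huv
    have e : H.connectedComponentMk u = H.connectedComponentMk v :=
      SimpleGraph.ConnectedComponent.sound huv.reachable
    obtain ⟨w, hw⟩ := (hreach v).exists_walk_length_eq_dist
    have := SimpleGraph.dist_le (Walk.cons huv w)
    simp only [D, e]
    rw [Walk.length_cons, hw] at this
    exact this
  have hstep : ∀ v k, D v = k + 1 → ∃ u, H.Adj v u ∧
      H.connectedComponentMk u = H.connectedComponentMk v ∧ D u = k := by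
    intro v k hk
    obtain ⟨w, hw⟩ := (hreach v).exists_walk_length_eq_dist
    have hw' : w.length = k + 1 := hw.trans hk
    generalize hr : root (H.connectedComponentMk v) = r at w
    cases w with
    | nil => simp at hw'
    | @cons _ u _ hadj p =>
      have e : H.connectedComponentMk u = H.connectedComponentMk v :=
        (SimpleGraph.ConnectedComponent.sound hadj.reachable).symm
      refine ⟨u, hadj, e, ?_⟩
      have h1 : D u ≤ k := by
        simp only [D, e, hr]
        refine (SimpleGraph.dist_le p).trans ?_
        simp at hw'; omega
      have := hDadj v u hadj
      omega
  have hcol : ∀ c i, Col G γ A {v | v ∈ S ∧ H.connectedComponentMk v = c ∧ D v = i} n := by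
    intro c i
    rcases i with _ | k
    · refine (col_subsingleton ?_).mono le_rfl hn
      rintro x ⟨_, hx, hx'⟩ y ⟨_, hy, hy'⟩
      rw [(hreach x).dist_eq_zero_iff] at hx'
      rw [(hreach y).dist_eq_zero_iff] at hy'
      rw [hx', hy', hx, hy]
    · refine hcon {v | v ∈ S ∧ H.connectedComponentMk v = c ∧ D v < k + 1} _
        (fun v hv => hv.1) (fun v hv => hv.1) ?_ ?_ ?_
      · rw [Set.disjoint_left]
        rintro v ⟨_, _, h1⟩ ⟨_, _, h2⟩
        omega
      · have key : ∀ m v, D v = m → v ∈ S → H.connectedComponentMk v = c → m < k + 1 →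
            ∃ w : G.Walk v (root c), ∀ z ∈ w.support,
              z ∈ {v | v ∈ S ∧ H.connectedComponentMk v = c ∧ D v < k + 1} := by
          intro m
          induction m with
          | zero =>
            intro v hv hvS hvc hm
            have hv0 := hv
            rw [(hreach v).dist_eq_zero_iff, hvc] at hv0
            subst hv0
            refine ⟨Walk.nil, ?_⟩
            intro z hz
            simp at hz
            subst hz
            exact ⟨hvS, hvc, by omega⟩
          | succ m ih =>
            intro v hv hvS hvc hm
            obtain ⟨u, hadj, hu, hDu⟩ := hstep v m hv
            obtain ⟨w, hw⟩ := ih u hDu hadj.2.2 (hu.trans hvc) (by omega)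
            refine ⟨Walk.cons hadj.1 w, ?_⟩
            intro z hz
            rw [Walk.support_cons, List.mem_cons] at hz
            rcases hz with rfl | hz
            · exact ⟨hvS, hvc, by omega⟩
            · exact hw z hz
        intro x hx y hy
        obtain ⟨w1, h1⟩ := key _ x rfl hx.1 hx.2.1 hx.2.2
        obtain ⟨w2, h2⟩ := key _ y rfl hy.1 hy.2.1 hy.2.2
        refine ⟨w1.append w2.reverse, ?_⟩
        intro z hz
        rw [Walk.mem_support_append_iff, Walk.support_reverse, List.mem_reverse] at hz
        exact hz.elim (h1 z) (h2 z)
      · rintro y ⟨hyS, hyc, hyD⟩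
        obtain ⟨u, hadj, hu, hDu⟩ := hstep y k hyD
        exact ⟨u, ⟨hadj.2.2, hu.trans hyc, by omega⟩, hadj.1⟩
  choose F hF hF' using hcol
  apply h
  refine ⟨fun v => 2 * F (H.connectedComponentMk v) (D v) v + D v % 2, ?_, ?_⟩
  · intro v hv
    have := hF (H.connectedComponentMk v) (D v) v ⟨hv, rfl, rfl⟩
    dsimp only
    omega
  · intro i v w hw hs
    have hc := const_on_walk (fun v => (H.connectedComponentMk v, D v)) (X := _) (by
      rintro x ⟨hx, hx'⟩ y ⟨hy, hy'⟩ hxy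
      have hH : H.Adj x y := ⟨hxy, hx, hy⟩
      have h1 := hDadj x y hH
      have h2 := hDadj y x hH.symm
      have h3 : D x = D y := by
        dsimp only at hx' hy'
        omega
      exact Prod.ext (SimpleGraph.ConnectedComponent.sound hH.reachable) h3) w hs
    refine hF' (H.connectedComponentMk v) (D v) (i / 2) v w hw ?_
    intro x hx
    have h1 := hc x hx
    rw [Prod.mk.injEq] at h1
    obtain ⟨h2, h3⟩ := hs x hx
    refine ⟨⟨h2, h1.1, h1.2⟩, ?_⟩
    dsimp only at h3
    rw [h1.1, h1.2] at h3
    omega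

/-- Long connector. -/
def LC (G : SimpleGraph V) (C Y : Set V) (d : ℕ) : Prop :=
  ∀ x ∈ Y, ∀ y ∈ Y, x ≠ y → ∃ p : G.Walk x y, p.IsPath ∧ d ≤ p.length ∧
    ∀ z ∈ p.support, z = x ∨ z = y ∨ z ∈ C

lemma lc_of_conn {C Y : Set V} (hC : Conn G C) (hY : ∀ y ∈ Y, ∃ c ∈ C, G.Adj y c) :
    LC G C Y 0 := by
  classical
  intro x hx y hy _
  obtain ⟨c, hc, hxc⟩ := hY x hx
  obtain ⟨e, he, hye⟩ := hY y hy
  obtain ⟨w, hw⟩ := hC c hc e he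
  let q : G.Walk x y := Walk.cons hxc (w.concat hye.symm)
  refine ⟨q.bypass, q.bypass_isPath, Nat.zero_le _, ?_⟩
  intro z hz
  have := q.support_bypass_subset_support hz
  simp only [q, Walk.support_cons, Walk.support_concat, List.mem_cons,
    List.mem_append, List.concat_eq_append, List.mem_nil_iff, or_false] at this
  rcases this with h | h | h
  · exact Or.inl h
  · exact Or.inr (Or.inr (hw z h))
  · exact Or.inr (Or.inl h)

lemma exists_lc (d : ℕ) : ∀ n : ℕ, 1 ≤ n → ∃ N : ℕ, 1 ≤ N ∧
    ∀ (Γ : Type v) [AddCommGroup Γ] (A : Set Γ) (V : Type u) (G : SimpleGraph V)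
      (γ : Sym2 V → Γ) (S : Set V), ¬ Col G γ A S N →
      ∃ C Y : Set V, C ⊆ S ∧ Y ⊆ S ∧ Disjoint C Y ∧ LC G C Y d ∧ ¬ Col G γ A Y n := by
  induction d with
  | zero =>
    intro n hn
    refine ⟨2 * n, by omega, ?_⟩
    intro Γ _ A V G γ S hS
    obtain ⟨C, Y, h1, h2, h3, h4, h5, h6⟩ := step hn hS
    exact ⟨C, Y, h1, h2, h3, lc_of_conn h4 h5, h6⟩
  | succ d ih =>
    intro n hn
    obtain ⟨N, hN, hNS⟩ := ih (2 * (n + 1)) (by omega)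
    refine ⟨N, hN, ?_⟩
    intro Γ _ A V G γ S hS
    obtain ⟨C, Y, hC, hY, hCY, hLC, hcol⟩ := hNS Γ A V G γ S hS
    obtain ⟨C', Y', h1, h2, h3, h4, h5, h6⟩ := step (by omega) hcol
    obtain ⟨w, hw, hwc⟩ := pick h6
    rw [Set.disjoint_left] at hCY h3
    refine ⟨C ∪ C' ∪ {w}, Y' \ {w}, ?_, ?_, ?_, ?_, hwc⟩
    · rintro x ((hx | hx) | rfl)
      · exact hC hx
      · exact hY (h1 hx)
      · exact hY (h2 hw)
    · exact fun x hx => hY (h2 hx.1)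
    · rw [Set.disjoint_left]
      rintro x ((hx | hx) | rfl) ⟨hx1, hx2⟩
      · exact hCY hx (h2 hx1)
      · exact h3 hx hx1
      · exact hx2 rfl
    · rintro x ⟨hx, hxw⟩ y ⟨hy, hyw⟩ hxy
      obtain ⟨p, hp, hpl, hps⟩ := hLC x (h2 hx) w (h2 hw) hxw
      obtain ⟨q, hq, -, hqs⟩ := lc_of_conn h4 h5 w hw y hy (fun h => hyw h.symm)
      refine ⟨p.append q, isPath_append hp hq ?_, ?_, ?_⟩
      · intro z hz hz'
        rcases hps z hz with rfl | rfl | hzC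
        · rcases hqs z hz' with h | h | h
          · exact h
          · exact absurd h hxy
          · exact absurd hx (h3 h)
        · rfl
        · rcases hqs z hz' with h | h | h
          · exact h
          · subst h
            exact absurd (h2 hy) (hCY hzC)
          · exact absurd (h1 h) (hCY hzC)
      · rw [Walk.length_append]
        have : q.length ≠ 0 := fun h0 => hyw (Walk.eq_of_length_eq_zero h0).symm
        omega
      · intro z hz
        rw [Walk.mem_support_append_iff] at hz
        rcases hz with hz | hz
        · rcases hps z hz with h | h | h
          · exact Or.inl h
          · exact Or.inr (Or.inr (Or.inr h))
          · exact Or.inr (Or.inr (Or.inl (Or.inl h)))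
        · rcases hqs z hz with h | h | h
          · exact Or.inr (Or.inr (Or.inr h))
          · exact Or.inr (Or.inl h)
          · exact Or.inr (Or.inr (Or.inl (Or.inr h)))

/-- Two routes along a nonzero cycle with distinct values. -/
lemma cycle_routes (γ : Sym2 V → Γ) (Λ : AddSubgroup Γ) {v : V} (w : G.Walk v v)
    (hw : w.IsCycle) (hval : walkVal γ w ∉ Λ) :
    ∃ (a b : V) (r1 r2 : G.Walk a b), a ≠ b ∧ r1.IsPath ∧ r2.IsPath ∧
      (∀ x ∈ r1.support, x ∈ w.support) ∧ (∀ x ∈ r2.support, x ∈ w.support) ∧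
      walkVal γ r1 - walkVal γ r2 ∉ Λ := by
  by_contra hcon
  push Not at hcon
  cases w with
  | nil => exact hw.not_nil (by simp)
  | @cons _ v1 _ h1 q =>
    rw [Walk.cons_isCycle_iff] at hw
    obtain ⟨hq, he⟩ := hw
    cases q with
    | nil => exact h1.ne rfl
    | @cons _ v2 _ h2 p =>
      have hq' := hq
      rw [Walk.cons_isPath_iff] at hq'
      obtain ⟨hp, hv1⟩ := hq'
      have hne : v2 ≠ v := by
        rintro rfl
        exact he (by simp [Sym2.eq_swap])
      have e1 := hcon v v1 (Walk.cons h1 Walk.nil) (Walk.cons h2 p).reverse h1.ne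
        (by simp [h1.ne]) hq.reverse (by simp) (by
          intro x hx; rw [Walk.support_reverse, List.mem_reverse] at hx
          rw [Walk.support_cons]; exact List.mem_cons_of_mem _ hx)
      have e2 := hcon v1 v2 (Walk.cons h2 Walk.nil) (p.concat h1).reverse h2.ne
        (by simp [h2.ne]) (hp.concat hv1 h1).reverse (by simp) (by
          intro x hx
          simp only [Walk.support_reverse, List.mem_reverse, Walk.support_concat,
            List.concat_eq_append, List.mem_append, List.mem_singleton] at hx
          simp only [Walk.support_cons, List.mem_cons]
          tauto)
      have e3 := hcon v2 v p (Walk.cons h2.symm (Walk.cons h1.symm Walk.nil)) hne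
        hp (by simp [h1.ne', h2.ne', hne]) (by intro x hx; simp [hx]) (by
          intro x hx; simp at hx ⊢
          rcases hx with rfl | rfl | rfl <;> simp)
      apply hval
      have hs := Λ.neg_mem (Λ.add_mem (Λ.add_mem e1 e2) e3)
      convert hs using 1
      simp only [walkVal_reverse, walkVal_cons, Walk.concat_eq_append, walkVal_append,
        Sym2.eq_swap (a := v2) (b := v1), Sym2.eq_swap (a := v1) (b := v)]
      have hnil : ∀ x : V, walkVal γ (Walk.nil : G.Walk x x) = 0 := fun x => by simp [walkVal]
      simp only [hnil]
      abel

/-- Connector with values in `A`. -/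
def AC (G : SimpleGraph V) (γ : Sym2 V → Γ) (A : Set Γ) (C Y : Set V) (d : ℕ) : Prop :=
  ∀ x ∈ Y, ∀ y ∈ Y, x ≠ y → ∃ p : G.Walk x y, p.IsPath ∧ d ≤ p.length ∧
    walkVal γ p ∈ A ∧ ∀ z ∈ p.support, z = x ∨ z = y ∨ z ∈ C

lemma join3 {C C' S Y : Set V} {x y a b : V} (hxy : x ≠ y) (hx : x ∈ Y) (hy : y ∈ Y)
    (ha : a ∈ S) (hb : b ∈ S)
    (h1 : Disjoint C C') (h2 : Disjoint C S) (h3 : Disjoint C' S) (h4 : Disjoint C Y)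
    (h5 : Disjoint C' Y) (h6 : Disjoint S Y)
    {p : G.Walk x a} {r : G.Walk a b} {q : G.Walk b y}
    (hab : a ≠ b)
    (hp : p.IsPath) (hr : r.IsPath) (hq : q.IsPath)
    (hps : ∀ z ∈ p.support, z = x ∨ z = a ∨ z ∈ C)
    (hrs : ∀ z ∈ r.support, z ∈ S)
    (hqs : ∀ z ∈ q.support, z = b ∨ z = y ∨ z ∈ C') :
    (p.append (r.append q)).IsPath ∧
      ∀ z ∈ (p.append (r.append q)).support, z = x ∨ z = y ∨ z ∈ C ∪ C' ∪ S := by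
  rw [Set.disjoint_left] at *
  have hrq : (r.append q).IsPath := by
    refine isPath_append hr hq ?_
    intro z hz hz'
    have := hrs z hz
    rcases hqs z hz' with h | h | h
    · exact h
    · subst h; exact absurd hy (h6 this)
    · exact absurd this (h3 h)
  refine ⟨isPath_append hp hrq ?_, ?_⟩
  · intro z hz hz'
    have hz2 : z ∈ S ∨ z = y ∨ z ∈ C' := by
      rw [Walk.mem_support_append_iff] at hz'
      rcases hz' with h | h
      · exact Or.inl (hrs z h)
      · rcases hqs z h with rfl | h | h
        · exact Or.inl hb
        · exact Or.inr (Or.inl h)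
        · exact Or.inr (Or.inr h)
    rcases hps z hz with rfl | h | h
    · rcases hz2 with h | h | h
      · exact absurd hx (h6 h)
      · exact absurd h hxy
      · exact absurd hx (h5 h)
    · exact h
    · rcases hz2 with h' | rfl | h'
      · exact absurd h' (h2 h)
      · exact absurd hy (h4 h)
      · exact absurd h' (h1 h)
  · intro z hz
    simp only [Walk.mem_support_append_iff] at hz
    rcases hz with hz | hz | hz
    · rcases hps z hz with h | rfl | h
      · exact Or.inl h
      · exact Or.inr (Or.inr (Or.inr ha))
      · exact Or.inr (Or.inr (Or.inl (Or.inl h)))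
    · exact Or.inr (Or.inr (Or.inr (hrs z hz)))
    · rcases hqs z hz with rfl | h | h
      · exact Or.inr (Or.inr (Or.inr hb))
      · exact Or.inr (Or.inl h)
      · exact Or.inr (Or.inr (Or.inl (Or.inr h)))

lemma exists_ac (d n : ℕ) (hn : 1 ≤ n) : ∃ N : ℕ, 1 ≤ N ∧
    ∀ (Γ : Type v) [AddCommGroup Γ] (A : Set Γ) (Λ : AddSubgroup Γ), (Λ : Set Γ) = Aᶜ →
      ∀ (V : Type u) [Finite V] (G : SimpleGraph V)
      (γ : Sym2 V → Γ) (S : Set V), ¬ Col G γ A S N →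
      ∃ C Y : Set V, C ⊆ S ∧ Y ⊆ S ∧ Disjoint C Y ∧ AC G γ A C Y d ∧ ¬ Col G γ A Y n := by
  obtain ⟨N, hN, hNS⟩ := exists_lc.{u, v} d (2 * (n + 2)) (by omega)
  refine ⟨N, hN, ?_⟩
  intro Γ _ A Λ hΛ V _ G γ S hS
  have hmem : ∀ g : Γ, g ∉ A → g ∈ Λ := fun g hg => by
    have : g ∈ (Λ : Set Γ) := by rw [hΛ]; exact hg
    exact this
  have hmem' : ∀ g : Γ, g ∈ A → g ∉ Λ := fun g hg hg' => by
    have : g ∈ (Λ : Set Γ) := hg'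
    rw [hΛ] at this; exact this hg
  obtain ⟨C, Y, hC, hY, hCY, hLC, hcol⟩ := hNS Γ A V G γ S hS
  obtain ⟨C', Y', h1, h2, h3, h4, h5, h6⟩ := step (by omega) hcol
  obtain ⟨O, hO, hOc, v, w, hw, hwO, hwA⟩ := pickCycle h6
  have hLC' := lc_of_conn h4 h5
  have d1 : Disjoint C C' := hCY.mono_right h1
  have d2 : Disjoint C O := hCY.mono_right (hO.trans h2)
  have d3 : Disjoint C' O := h3.mono_right hO
  have d4 : Disjoint C (Y' \ O) := hCY.mono_right (Set.sdiff_subset.trans h2)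
  have d5 : Disjoint C' (Y' \ O) := h3.mono_right Set.sdiff_subset
  have d6 : Disjoint O (Y' \ O) := Set.disjoint_sdiff_right
  refine ⟨C ∪ C' ∪ O, Y' \ O, ?_, ?_, ?_, ?_, hOc⟩
  · rintro x ((hx | hx) | hx)
    · exact hC hx
    · exact hY (h1 hx)
    · exact hY (h2 (hO hx))
  · exact fun x hx => hY (h2 hx.1)
  · exact Disjoint.union_left (Disjoint.union_left d4 d5) d6
  · intro x hx y hy hxy
    obtain ⟨a, b, r1, r2, hab, hr1, hr2, hs1, hs2, hdiff⟩ :=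
      cycle_routes γ Λ w hw (hmem' _ hwA)
    have haO : a ∈ O := hwO a (hs1 a (by simp))
    have hbO : b ∈ O := hwO b (hs1 b (by simp))
    obtain ⟨p, hp, hpl, hps⟩ := hLC x (h2 hx.1) a (h2 (hO haO))
      (fun h => hx.2 (h ▸ haO))
    obtain ⟨q, hq, -, hqs⟩ := hLC' b (hO hbO) y hy.1 (fun h => hy.2 (h ▸ hbO))
    have hor : walkVal γ (p.append (r1.append q)) ∈ A ∨
        walkVal γ (p.append (r2.append q)) ∈ A := by
      by_contra hcon
      push Not at hcon
      apply hdiff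
      have := Λ.sub_mem (hmem _ hcon.1) (hmem _ hcon.2)
      simp only [walkVal_append] at this
      convert this using 1
      abel
    rcases hor with hor | hor
    · obtain ⟨g1, g2⟩ := join3 hxy hx hy haO hbO d1 d2 d3 d4 d5 d6 hab hp hr1 hq hps
        (fun z hz => hwO z (hs1 z hz)) hqs
      exact ⟨_, g1, by rw [Walk.length_append]; omega, hor, g2⟩
    · obtain ⟨g1, g2⟩ := join3 hxy hx hy haO hbO d1 d2 d3 d4 d5 d6 hab hp hr2 hq hps
        (fun z hz => hwO z (hs2 z hz)) hqs
      exact ⟨_, g1, by rw [Walk.length_append]; omega, hor, g2⟩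

lemma exists_family (d m : ℕ) : ∀ n : ℕ, 1 ≤ n → ∃ N : ℕ, 1 ≤ N ∧
    ∀ (Γ : Type v) [AddCommGroup Γ] (A : Set Γ) (Λ : AddSubgroup Γ), (Λ : Set Γ) = Aᶜ →
      ∀ (V : Type u) [Finite V] (G : SimpleGraph V)
      (γ : Sym2 V → Γ) (S : Set V), ¬ Col G γ A S N →
      ∃ (C : ℕ → Set V) (Y : Set V), Y ⊆ S ∧ (∀ i < m, C i ⊆ S ∧ Disjoint (C i) Y ∧
        AC G γ A (C i) Y d) ∧ (∀ i < m, ∀ j < m, i ≠ j → Disjoint (C i) (C j)) ∧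
        ¬ Col G γ A Y n := by
  induction m with
  | zero =>
    intro n hn
    refine ⟨n, hn, ?_⟩
    intro Γ _ A Λ hΛ V _ G γ S hS
    exact ⟨fun _ => ∅, S, le_rfl, by simp, by simp, hS⟩
  | succ m ih =>
    intro n hn
    obtain ⟨N1, hN1, h1⟩ := exists_ac.{u, v} d n hn
    obtain ⟨N, hN, h2⟩ := ih N1 hN1
    refine ⟨N, hN, ?_⟩
    intro Γ _ A Λ hΛ V _ G γ S hS
    obtain ⟨C, Y, hY, hC, hCd, hcol⟩ := h2 Γ A Λ hΛ V G γ S hS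
    obtain ⟨C', Y', g1, g2, g3, g4, g5⟩ := h1 Γ A Λ hΛ V G γ Y hcol
    refine ⟨fun i => if i < m then C i else C', Y', g2.trans hY, ?_, ?_, g5⟩
    · intro i _
      by_cases hi : i < m
      · simp only [hi, if_true]
        obtain ⟨k1, k2, k3⟩ := hC i hi
        exact ⟨k1, k2.mono_right g2, fun x hx y hy => k3 x (g2 hx) y (g2 hy)⟩
      · simp only [hi, if_false]
        exact ⟨g1.trans hY, g3, g4⟩
    · intro i _ j _ hij
      by_cases hi : i < m <;> by_cases hj : j < m
      · simp only [hi, hj, if_true]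
        exact hCd i hi j hj hij
      · simp only [hi, hj, if_true, if_false]
        exact (hC i hi).2.1.mono_right g1
      · simp only [hi, hj, if_true, if_false]
        exact ((hC j hj).2.1.mono_right g1).symm
      · omega

lemma pickMany {γ : Sym2 V → Γ} {A : Set Γ} (t : ℕ) : ∀ {Y : Set V}, ¬ Col G γ A Y (t + 1) →
    ∃ b : Fin t → V, Function.Injective b ∧ ∀ i, b i ∈ Y := by
  induction t with
  | zero => intro Y _; exact ⟨Fin.elim0, fun i => i.elim0, fun i => i.elim0⟩
  | succ t ih =>
    intro Y h
    obtain ⟨w, hw, hwc⟩ := pick h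
    obtain ⟨b, hb, hbY⟩ := ih hwc
    refine ⟨Fin.cons w b, ?_, ?_⟩
    · rw [Fin.cons_injective_iff]
      refine ⟨?_, hb⟩
      rintro ⟨i, hi⟩
      exact (hbY i).2 hi
    · intro i
      refine Fin.cases ?_ (fun i => ?_) i
      · exact hw
      · exact (hbY i).1

lemma final (t d : ℕ) : ∃ N : ℕ,
    ∀ (Γ : Type v) [AddCommGroup Γ] (A : Set Γ) (Λ : AddSubgroup Γ), (Λ : Set Γ) = Aᶜ →
      ∀ (V : Type u) [Finite V] (G : SimpleGraph V)
      (γ : Sym2 V → Γ), N < arb G γ A → ContainsADSubdivision G γ A t d := by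
  obtain ⟨N, -, hN⟩ := exists_family.{u, v} d (t * t) (t + 1) (by omega)
  refine ⟨N, ?_⟩
  intro Γ _ A Λ hΛ V _ G γ harb
  have hcol : ¬ Col G γ A Set.univ N := by
    rintro ⟨f, hf, hf'⟩
    refine absurd harb (not_lt.mpr (Nat.sInf_le ?_))
    refine ⟨fun v => ⟨f v, hf v trivial⟩, fun i => (hf' i).mono ?_⟩
    rintro v ⟨hv, hvi⟩
    exact ⟨hv, by rw [← hvi]⟩
  obtain ⟨C, Y, -, hC, hCd, hY⟩ := hN Γ A Λ hΛ V G γ Set.univ hcol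
  obtain ⟨b, hb, hbY⟩ := pickMany t hY
  let e : Fin t → Fin t → ℕ := fun i j => i.val * t + j.val
  have he : ∀ i j, e i j < t * t := by
    intro i j
    have hi := i.isLt
    have hj := j.isLt
    calc i.val * t + j.val < i.val * t + t := by omega
      _ = (i.val + 1) * t := by ring
      _ ≤ t * t := Nat.mul_le_mul_right _ hi
  have hinj : ∀ i j k l, e i j = e k l → i = k ∧ j = l := by
    intro i j k l h
    have hj := j.isLt
    have hl := l.isLt
    have ht : 0 < t := by omega
    have h1 : (i.val * t + j.val) / t = (k.val * t + l.val) / t := congrArg (· / t) h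
    have h2 : (i.val * t + j.val) % t = (k.val * t + l.val) % t := congrArg (· % t) h
    rw [mul_comm, mul_comm k.val, Nat.mul_add_div ht, Nat.mul_add_div ht,
      Nat.div_eq_of_lt hj, Nat.div_eq_of_lt hl] at h1
    rw [mul_comm, mul_comm k.val, Nat.mul_add_mod, Nat.mul_add_mod,
      Nat.mod_eq_of_lt hj, Nat.mod_eq_of_lt hl] at h2
    exact ⟨Fin.ext (by omega), Fin.ext h2⟩
  have hP : ∀ i j : Fin t, ∃ p : G.Walk (b i) (b j), i ≠ j → p.IsPath ∧ d ≤ p.length ∧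
      walkVal γ p ∈ A ∧ ∀ z ∈ p.support, z = b i ∨ z = b j ∨ z ∈ C (e i j) := by
    intro i j
    by_cases hij : i = j
    · subst hij
      exact ⟨Walk.nil, fun h => absurd rfl h⟩
    · obtain ⟨p, hp⟩ := (hC _ (he i j)).2.2 (b i) (hbY i) (b j) (hbY j)
        (fun h => hij (hb h))
      exact ⟨p, fun _ => hp⟩
  choose P hP using hP
  have hCb : ∀ i j k, b k ∉ C (e i j) := fun i j k hk =>
    Set.disjoint_left.mp (hC _ (he i j)).2.1 hk (hbY k)
  refine ⟨b, P, ⟨hb, ?_, ?_, ?_⟩, ?_⟩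
  · exact fun i j hij => (hP i j hij.ne).1
  · rintro i j hij v hv ⟨k, rfl⟩
    rcases (hP i j hij.ne).2.2.2 _ hv with h | h | h
    · exact Or.inl h
    · exact Or.inr h
    · exact absurd h (hCb i j k)
  · intro i j k l hij hkl hne v hv hv'
    have a1 := (hP i j hij.ne).2.2.2 _ hv
    have a2 := (hP k l hkl.ne).2.2.2 _ hv'
    have hne' : e i j ≠ e k l := fun h => hne (by
      obtain ⟨h1, h2⟩ := hinj _ _ _ _ h
      rw [h1, h2])
    have hdis := Set.disjoint_left.mp (hCd _ (he i j) _ (he k l) hne')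
    by_cases hvb : v ∈ Set.range b
    · obtain ⟨m, rfl⟩ := hvb
      have c1 := hCb i j m
      have c2 := hCb k l m
      tauto
    · have n : ∀ m, v ≠ b m := fun m hm => hvb ⟨m, hm.symm⟩
      have b1 : v ∈ C (e i j) := by
        rcases a1 with h | h | h
        · exact absurd h (n _)
        · exact absurd h (n _)
        · exact h
      have b2 : v ∈ C (e k l) := by
        rcases a2 with h | h | h
        · exact absurd h (n _)
        · exact absurd h (n _)
        · exact h
      exact absurd b2 (hdis b1)
  · exact fun i j hij => ⟨(hP i j hij.ne).2.2.1, (hP i j hij.ne).2.1⟩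

end Helpers

theorem statement15 :
    ∃ f : ℕ × ℕ → ℝ,
      ∀ (Γ : Type v) [AddCommGroup Γ] (A : Set Γ), A.Nonempty →
        (∃ Λ : AddSubgroup Γ, (Λ : Set Γ) = Aᶜ) →
        ∀ (V : Type u) [Fintype V] (G : SimpleGraph V) (γ : Sym2 V → Γ) (t d : ℕ),
          f (t, d) ≤ (arb G γ A : ℝ) →
          ContainsADSubdivision G γ A t d := by
  choose N hN using final.{u, v}
  refine ⟨fun x => ((N x.1 x.2 + 1 : ℕ) : ℝ), ?_⟩
  rintro Γ _ A - ⟨Λ, hΛ⟩ V _ G γ t d h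
  refine hN t d Γ A Λ hΛ V G γ ?_
  dsimp only at h
  have : N t d + 1 ≤ arb G γ A := by exact_mod_cast h
  omega

end ArbPaper
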